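/- For every natural number k ≥ 1 and every real number x > 0, one has (k−1+(k−1+x)²)·k!·f_k(x) < k·(k−1+x)·x^k. -/

import Mathlib

/-- The signed tail of the Taylor series of `e^{-x}`:
`f k x = (-1)^k ∑_{j=k}^∞ (-x)^j / j!`. -/
noncomputable def f (k : ℕ) (x : ℝ) : ℝ :=
  (-1 : ℝ) ^ k * ∑' j : ℕ, (-x) ^ (k + j) / (Nat.factorial (k + j))

theorem f_zero_eq (x : ℝ) : f 0 x = Real.exp (-x) := by
  rw [Real.exp_eq_exp_ℝ, NormedSpace.exp_eq_tsum_div]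
  simp [f]

theorem f_succ_eq (k : ℕ) (x : ℝ) : f (k + 1) x = x ^ k / (Nat.factorial k) - f k x := by
  have hs : Summable (fun j : ℕ => (-x) ^ (k + j) / ((Nat.factorial (k + j) : ℕ) : ℝ)) := by
    have h := (summable_nat_add_iff k).2 (Real.summable_pow_div_factorial (-x))
    simpa [add_comm] using h
  have h1 := hs.tsum_eq_zero_add
  have h2 : (fun j : ℕ => (-x) ^ (k + (j + 1)) / ((Nat.factorial (k + (j + 1)) : ℕ) : ℝ))
      = fun j : ℕ => (-x) ^ (k + 1 + j) / ((Nat.factorial (k + 1 + j) : ℕ) : ℝ) := by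
    funext j
    rw [show k + (j + 1) = k + 1 + j by ring]
  rw [h2] at h1
  unfold f
  rw [h1]
  have h3 : (-1 : ℝ) ^ k * (-x) ^ k = x ^ k := by
    rw [← mul_pow]; simp
  simp only [add_zero]
  rw [← h3]
  ring

theorem f_hasDeriv (k : ℕ) (x : ℝ) : HasDerivAt (f (k + 1)) (f k x) x := by
  induction k with
  | zero =>
    have h : f (0 + 1) = fun y => 1 - Real.exp (-y) := by
      funext y
      rw [f_succ_eq, f_zero_eq]; simp
    rw [h, f_zero_eq]
    have := ((hasDerivAt_neg x).exp).const_sub 1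
    simpa using this
  | succ k ih =>
    have h : f (k + 1 + 1) = fun y => y ^ (k + 1) / (Nat.factorial (k + 1)) - f (k + 1) y := by
      funext y
      rw [f_succ_eq]
    rw [h]
    have h1 := ((hasDerivAt_pow (k + 1) x).div_const (Nat.factorial (k + 1) : ℝ)).sub ih
    refine h1.congr_deriv ?_
    rw [f_succ_eq k x, Nat.factorial_succ]
    have : (Nat.factorial k : ℝ) ≠ 0 := by positivity
    have : (k : ℝ) + 1 ≠ 0 := by positivity
    push_cast
    try simp only [Nat.add_sub_cancel]
    field_simp

theorem f_succ_at_zero (k : ℕ) : f (k + 1) 0 = 0 := by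
  simp [f, Nat.add_right_comm]

theorem stmt_7 (k : ℕ) (hk : 1 ≤ k) (x : ℝ) (hx : 0 < x) :
    ((k : ℝ) - 1 + ((k : ℝ) - 1 + x) ^ 2) * (Nat.factorial k) * f k x <
      (k : ℝ) * ((k : ℝ) - 1 + x) * x ^ k := by
  obtain ⟨m, rfl⟩ : ∃ m, k = m + 1 := ⟨k - 1, by omega⟩
  rcases Nat.eq_zero_or_pos m with rfl | hm
  · rw [f_succ_eq, f_zero_eq]
    have := Real.exp_pos (-x)
    have h2 : 0 < x ^ 2 := by positivity
    simp
    nlinarith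
  have hm' : (0 : ℝ) < m := by exact_mod_cast hm
  let U : ℝ → ℝ := fun y => ((m : ℝ) + 1) * (m + y) / (m + (m + y) ^ 2)
  let H : ℝ → ℝ := fun y => Real.exp y * (U y * y ^ (m + 1) - (Nat.factorial (m + 1)) * f (m + 1) y)
  have hD : ∀ y : ℝ, HasDerivAt H (Real.exp y * (2 * (m + 1) * m * y / (m + (m + y) ^ 2) ^ 2 * y ^ m)) y := by
    intro y
    have hden : (m : ℝ) + (m + y) ^ 2 ≠ 0 := by positivity
    have hs : HasDerivAt (fun y : ℝ => (m : ℝ) + y) 1 y := (hasDerivAt_id y).const_add _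
    have hU := (hs.const_mul ((m : ℝ) + 1)).div ((hs.pow 2).const_add (m : ℝ)) hden
    have h := (Real.hasDerivAt_exp y).mul ((hU.mul (hasDerivAt_pow (m + 1) y)).sub
      ((f_hasDeriv m y).const_mul (Nat.factorial (m + 1) : ℝ)))
    refine h.congr_deriv ?_
    have hf : (Nat.factorial m : ℝ) ≠ 0 := by positivity
    simp only [f_succ_eq m y, Nat.factorial_succ, Pi.mul_apply, Pi.sub_apply, Pi.div_apply, Pi.pow_apply, Nat.add_sub_cancel]
    push_cast
    field_simp
    ring
  have hmono : StrictMonoOn H (Set.Ici 0) := by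
    apply strictMonoOn_of_deriv_pos (convex_Ici 0)
    · exact fun y _ => (hD y).continuousAt.continuousWithinAt
    · intro y hy
      rw [interior_Ici] at hy
      have hy : 0 < y := hy
      rw [(hD y).deriv]
      positivity
  have h0 := hmono (Set.mem_Ici.2 le_rfl) (Set.mem_Ici.2 hx.le) hx
  have hH0 : H 0 = 0 := by simp [H, f_succ_at_zero]
  rw [hH0] at h0
  have h1 := (mul_pos_iff_of_pos_left (Real.exp_pos x)).1 h0
  have hden : 0 < (m : ℝ) + (m + x) ^ 2 := by positivity
  have h2 := mul_pos hden h1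
  have h3 : ((m : ℝ) + (m + x) ^ 2) * U x = (m + 1) * (m + x) := by
    simp only [U]; field_simp
  push_cast at h2 ⊢
  rw [mul_sub, ← mul_assoc, h3] at h2
  simp only [add_sub_cancel_right]
  linarith
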